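/- arXiv:2406.09632 — 12 statements merged into one kernel-verified Lean document; each statement's English description precedes it below -/
import Mathlib

section
/- Let p be a prime, R a commutative ring of characteristic p, and k, k' integers with k' > k ≥ 0. Let f₁, f₂, f₃ ∈ R[x] be polynomials with deg f₃ < p^k. Then D_{p^k}(f₁^{p^{k'}} · f₂^{p^k} · f₃) = f₁^{p^{k'}} · (f₂')^{p^k} · f₃, where f₂' denotes the formal derivative of f₂. Equivalently, for every n ≥ 0, the image in R of the natural number ⌊(n + p^k)/p^k⌋ multiplied by the coefficient of x^{n+p^k} in f₁^{p^{k'}} · f₂^{p^k} · f₃ equals the coefficient of x^n in f₁^{p^{k'}} · (f₂')^{p^k} · f₃. -/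
open Polynomial in
/-- If `deg g < q`, multiplying `expand R q f` by `g` places shifted copies of `g` side by side
without overlap. -/
theorem Polynomial.coeff_expand_mul_of_degree_lt {R : Type*} [CommSemiring R] {q : ℕ}
    (hq : 0 < q) (f : R[X]) {g : R[X]} (hg : g.degree < (q : ℕ)) (n : ℕ) :
    (expand R q f * g).coeff n = f.coeff (n / q) * g.coeff (n % q) := by
  rw [coeff_mul, Finset.sum_eq_single (q * (n / q), n % q)]
  · rw [coeff_expand_mul' hq]
  · rintro ⟨a, b⟩ hab hne
    rw [Finset.HasAntidiagonal.mem_antidiagonal] at hab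
    dsimp only at hab ⊢
    by_cases hb : q ≤ b
    · rw [coeff_eq_zero_of_degree_lt (hg.trans_le (by exact_mod_cast hb)), mul_zero]
    · rw [coeff_expand hq, if_neg, zero_mul]
      rintro ⟨c, rfl⟩
      apply hne
      rw [← hab, Nat.mul_add_div hq, Nat.mul_add_mod, Nat.div_eq_of_lt (by omega),
        Nat.mod_eq_of_lt (by omega), add_zero]
  · intro h
    exact absurd (Finset.HasAntidiagonal.mem_antidiagonal.mpr (Nat.div_add_mod n q)) h

open Polynomial in
theorem Polynomial.derivative_pow_mul_of_charP {R : Type*} [CommRing R] (p : ℕ) [CharP R p]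
    {m : ℕ} (hm : p ∣ m) (f g : R[X]) :
    derivative (f ^ m * g) = f ^ m * derivative g := by
  rw [derivative_mul, derivative_pow, (CharP.cast_eq_zero_iff R p m).mpr hm]
  simp


/-- Lemma `property of Dpk2`: for a prime `p`, a commutative ring `R` of characteristic `p`,
integers `k' > k ≥ 0`, and polynomials `f₁ f₂ f₃ ∈ R[x]` with `deg f₃ < p^k`, we have
`D_{p^k}(f₁^{p^{k'}} f₂^{p^k} f₃) = f₁^{p^{k'}} (f₂')^{p^k} f₃`, stated coefficient-wise:
for every `n ≥ 0`, `⌊(n + p^k)/p^k⌋ · coeff_{n+p^k}(f₁^{p^{k'}} f₂^{p^k} f₃)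
= coeff_n (f₁^{p^{k'}} (f₂')^{p^k} f₃)`. -/
theorem stmt_0 (p : ℕ) (hp : p.Prime) (R : Type*) [CommRing R] [CharP R p]
    (k k' : ℕ) (hkk' : k < k') (f₁ f₂ f₃ : Polynomial R)
    (hdeg : f₃.degree < (p ^ k : ℕ)) (n : ℕ) :
    (((n + p ^ k) / p ^ k : ℕ) : R) *
        (f₁ ^ p ^ k' * f₂ ^ p ^ k * f₃).coeff (n + p ^ k)
      = (f₁ ^ p ^ k' * (Polynomial.derivative f₂) ^ p ^ k * f₃).coeff n := by
  have := Fact.mk hp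
  have hq : 0 < p ^ k := pow_pos hp.pos k
  have hpow : p ^ k' = p ^ (k' - k) * p ^ k := by rw [← pow_add, Nat.sub_add_cancel hkk'.le]
  have hdvd : p ∣ p ^ (k' - k) := dvd_pow_self p (Nat.sub_ne_zero_of_lt hkk')
  rw [hpow, pow_mul, ← mul_pow, ← mul_pow, ← Polynomial.derivative_pow_mul_of_charP p hdvd,
    ← Polynomial.map_iterateFrobenius_expand p _ k, ← Polynomial.map_iterateFrobenius_expand p _ k,
    Polynomial.map_expand, Polynomial.map_expand,
    Polynomial.coeff_expand_mul_of_degree_lt hq _ hdeg,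
    Polynomial.coeff_expand_mul_of_degree_lt hq _ hdeg,
    ← Polynomial.derivative_map, Polynomial.coeff_derivative, Nat.add_mod_right,
    Nat.add_div_right n hq]
  push_cast
  ring
end

section
/- Let p be a prime, r ≥ 2 an integer, b₁,…,b_r and N nonnegative integers, and t a nonnegative integer with t ≤ b_r and t ≤ N. Write Q(x) for the polynomial obtained from F(b₁,…,b_r;N) by the substitution x_r = x_{r−1} + x, viewed as a polynomial in the single variable x over F_p[x₁,…,x_{r−1}], and write Q_t(x) for the polynomial obtained in the same way from F(b₁,…,b_{r−1}, b_r − t; N − t). Then the t-th derivative of Q with respect to x equals t! · C(b_r, t) · Q_t(x). -/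
open Polynomial MvPolynomial

/-- `Fpoly p b N = ∑_{n₁+⋯+n_r = N} C(b₁,n₁)⋯C(b_r,n_r) x₁^{n₁}⋯x_r^{n_r}` in `F_p[x₁,…,x_r]`. -/
noncomputable def Fpoly (p : ℕ) {r : ℕ} (b : Fin r → ℕ) (N : ℕ) :
    MvPolynomial (Fin r) (ZMod p) :=
  ∑ n ∈ Finset.Nat.antidiagonalTuple r N,
    MvPolynomial.C (∏ k, ((b k).choose (n k) : ZMod p)) * ∏ k, MvPolynomial.X k ^ n k

/-- The substitution `x_r = x_{r-1} + x`, sending a polynomial in `F_p[x₁,…,x_r]` (with `r = s+2`)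
to a polynomial in the single variable `x` over `F_p[x₁,…,x_{r-1}]` (embedded in
`F_p[x₁,…,x_r]`). -/
noncomputable def substLast (p s : ℕ) :
    MvPolynomial (Fin (s + 2)) (ZMod p) →ₐ[ZMod p]
      Polynomial (MvPolynomial (Fin (s + 2)) (ZMod p)) :=
  MvPolynomial.aeval (fun i => if i = Fin.last (s + 1)
    then Polynomial.C (MvPolynomial.X (Fin.castSucc (Fin.last s))) + Polynomial.X
    else Polynomial.C (MvPolynomial.X i))

theorem coeff_Fpoly (p : ℕ) {r : ℕ} (b : Fin r → ℕ) (N : ℕ) (m : Fin r →₀ ℕ) :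
    (Fpoly p b N).coeff m =
      if ∑ k, m k = N then ∏ k, ((b k).choose (m k) : ZMod p) else 0 := by
  have key (n : Fin r → ℕ) :
      MvPolynomial.C (∏ k, ((b k).choose (n k) : ZMod p)) * ∏ k, MvPolynomial.X k ^ n k =
        MvPolynomial.monomial (Finsupp.equivFunOnFinite.symm n)
          (∏ k, ((b k).choose (n k) : ZMod p)) := by
    rw [MvPolynomial.monomial_eq, Finsupp.prod_fintype _ _ (by simp)]
    simp
  simp only [Fpoly, key, MvPolynomial.coeff_sum, MvPolynomial.coeff_monomial,
    Equiv.symm_apply_eq]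
  rw [Finset.sum_ite_eq' _ _ _]
  simp [Finset.Nat.mem_antidiagonalTuple]

theorem pderiv_Fpoly (p : ℕ) {r : ℕ} (b : Fin r → ℕ) (N : ℕ) (i : Fin r) :
    MvPolynomial.pderiv i (Fpoly p b (N + 1)) =
      MvPolynomial.C (b i : ZMod p) * Fpoly p (Function.update b i (b i - 1)) N := by
  ext m
  have hsum : ∑ k, (m + Finsupp.single i 1 : Fin r →₀ ℕ) k = ∑ k, m k + 1 := by
    simp [Finset.sum_add_distrib, Finsupp.single_apply]
  rw [MvPolynomial.coeff_pderiv, MvPolynomial.coeff_C_mul, coeff_Fpoly, coeff_Fpoly, hsum]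
  simp only [add_left_inj]
  split_ifs with h
  · have hchoose : ((b i).choose (m i + 1) : ZMod p) * (m i + 1) =
        b i * (b i - 1).choose (m i) := by
      cases hb : b i with
      | zero => simp
      | succ c =>
        rw [Nat.add_sub_cancel]
        exact_mod_cast congrArg (Nat.cast : ℕ → ZMod p) (Nat.add_one_mul_choose_eq c (m i)).symm
    rw [← Finset.mul_prod_erase _ _ (Finset.mem_univ i),
      ← Finset.mul_prod_erase _ _ (Finset.mem_univ i)]
    have hprod : ∏ k ∈ Finset.univ.erase i,
          ((b k).choose ((m + Finsupp.single i 1 : Fin r →₀ ℕ) k) : ZMod p) =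
        ∏ k ∈ Finset.univ.erase i,
          ((Function.update b i (b i - 1) k).choose (m k) : ZMod p) := by
      refine Finset.prod_congr rfl fun k hk => ?_
      have hki := Finset.ne_of_mem_erase hk
      simp [hki]
    rw [hprod]
    simp only [Finsupp.add_apply, Finsupp.single_eq_same, Function.update_self]
    linear_combination (∏ k ∈ Finset.univ.erase i,
      ((Function.update b i (b i - 1) k).choose (m k) : ZMod p)) * hchoose
  · simp

theorem iterate_pderiv_Fpoly (p : ℕ) {r : ℕ} (b : Fin r → ℕ) (N t : ℕ) (i : Fin r)
    (ht : t ≤ N) :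
    (⇑(MvPolynomial.pderiv i))^[t] (Fpoly p b N) =
      MvPolynomial.C ((b i).descFactorial t : ZMod p) *
        Fpoly p (Function.update b i (b i - t)) (N - t) := by
  induction t with
  | zero => simp
  | succ t ih =>
    obtain ⟨M, hM⟩ : ∃ M, N - t = M + 1 := ⟨N - t - 1, by omega⟩
    rw [Function.iterate_succ_apply', ih (by omega), MvPolynomial.pderiv_C_mul, hM,
      pderiv_Fpoly, Nat.descFactorial_succ, show N - (t + 1) = M by omega]
    simp only [Function.update_self, Function.update_idem, Nat.sub_sub,
      Nat.cast_mul, MvPolynomial.C_mul]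
    ring

theorem derivative_substLast (p s : ℕ) (f : MvPolynomial (Fin (s + 2)) (ZMod p)) :
    Polynomial.derivative (substLast p s f) =
      substLast p s (MvPolynomial.pderiv (Fin.last (s + 1)) f) := by
  induction f using MvPolynomial.induction_on with
  | C a => simp [substLast, Polynomial.algebraMap_apply]
  | add f g hf hg => simp [hf, hg]
  | mul_X f i hf =>
    have hX : Polynomial.derivative (substLast p s (MvPolynomial.X i)) =
        substLast p s (MvPolynomial.pderiv (Fin.last (s + 1)) (MvPolynomial.X i)) := by
      by_cases hi : i = Fin.last (s + 1)
      · simp [substLast, hi]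
      · simp [substLast, hi, MvPolynomial.pderiv_X_of_ne hi]
    simp only [map_mul, Polynomial.derivative_mul, Derivation.leibniz, smul_eq_mul, map_add,
      hf, hX]
    ring

/-- Part (1) of Lemma `derivative and zero`: with `Q(x)` obtained from `F(b₁,…,b_r;N)` by the
substitution `x_r = x_{r-1} + x` and `Q_t(x)` obtained likewise from
`F(b₁,…,b_{r-1}, b_r - t; N - t)`, for `t ≤ b_r`, `t ≤ N`, the `t`-th derivative of `Q`
equals `t! · C(b_r, t) · Q_t(x)`. -/
theorem stmt_1 (p : ℕ) (hp : p.Prime) (s : ℕ) (b : Fin (s + 2) → ℕ) (N t : ℕ)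
    (ht1 : t ≤ b (Fin.last (s + 1))) (ht2 : t ≤ N) :
    (⇑Polynomial.derivative)^[t] (substLast p s (Fpoly p b N))
      = Polynomial.C (MvPolynomial.C
            ((t.factorial : ZMod p) * ((b (Fin.last (s + 1))).choose t : ZMod p)))
          * substLast p s
              (Fpoly p (Function.update b (Fin.last (s + 1)) (b (Fin.last (s + 1)) - t))
                (N - t)) := by
  have hcomm : Function.Semiconj (substLast p s)
      (MvPolynomial.pderiv (Fin.last (s + 1))) Polynomial.derivative :=
    fun f => (derivative_substLast p s f).symm
  rw [← (hcomm.iterate_right t).eq, iterate_pderiv_Fpoly p b N t _ ht2, map_mul,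
    Nat.descFactorial_eq_factorial_mul_choose, Nat.cast_mul]
  congr 1
  simp [substLast]
end

section
/- Let p be a prime, r ≥ 2 an integer, and b₁,…,b_r nonnegative integers with b_k ≤ p−1 for all k. Set t = max(0, b_{r−1} + b_r − (p−1)), and let N be an integer with t ≤ N ≤ b₁ + ⋯ + b_r. Write Q(x) for the polynomial obtained from F(b₁,…,b_r;N) by the substitution x_r = x_{r−1} + x, viewed as a polynomial in the single variable x over F_p[x₁,…,x_{r−1}]. Then the polynomial (∂^t Q/∂x^t)(0) ∈ F_p[x₁,…,x_{r−1}] is not identically zero, and every monomial occurring in it with nonzero coefficient has degree at most p−1 in each of the variables x₁,…,x_{r−1}. -/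
open Polynomial MvPolynomial

open Finset in
theorem sum_antidiagonalTuple_choose {A : Type*} [CommRing A] (r N : ℕ) (b : Fin r → ℕ)
    (y : Fin r → A) :
    ∑ n ∈ Finset.Nat.antidiagonalTuple r N, ∏ k, (((b k).choose (n k) : A) * y k ^ n k) =
      (∏ k, (1 + Polynomial.C (y k) * Polynomial.X) ^ b k : Polynomial A).coeff N := by
  have coeff_one_add (a : A) (m n : ℕ) :
      ((1 + Polynomial.C a * Polynomial.X) ^ m : Polynomial A).coeff n = m.choose n * a ^ n := by
    have h : ((1 + Polynomial.C a * Polynomial.X) ^ m : Polynomial A) =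
        ((1 + Polynomial.X) ^ m : Polynomial A).comp (Polynomial.C a * Polynomial.X) := by
      simp
    rw [h, Polynomial.comp_C_mul_X_coeff, Polynomial.coeff_one_add_X_pow]
  induction r generalizing N with
  | zero =>
    rcases N with _ | N
    · simp
    · simp [Polynomial.coeff_one]
  | succ r ih =>
    rw [Fin.prod_univ_succ, Polynomial.coeff_mul]
    have h : Finset.Nat.antidiagonalTuple (r + 1) N =
        (antidiagonal N).biUnion fun ij =>
          (Finset.Nat.antidiagonalTuple r ij.2).image (Fin.cons ij.1) := by
      ext n
      simp only [Finset.Nat.mem_antidiagonalTuple, mem_biUnion,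
        HasAntidiagonal.mem_antidiagonal, mem_image]
      constructor
      · intro hn
        refine ⟨(n 0, ∑ i, Fin.tail n i), ?_, Fin.tail n, rfl, Fin.cons_self_tail n⟩
        rw [← hn, Fin.sum_univ_succ]
        rfl
      · rintro ⟨⟨i, j⟩, hij, m, hm, rfl⟩
        simp only at hij hm
        rw [Fin.sum_univ_succ]
        simp [hm, hij]
    rw [h, sum_biUnion]
    · refine sum_congr rfl fun ij _ => ?_
      rw [sum_image (fun _ _ _ _ hxy => Fin.cons_right_injective _ hxy), coeff_one_add, ← ih,
        mul_sum]
      refine sum_congr rfl fun n _ => ?_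
      rw [Fin.prod_univ_succ]
      simp
    · intro u hu v hv huv
      refine Finset.disjoint_left.2 fun n hn hn' => huv ?_
      obtain ⟨m, -, rfl⟩ := mem_image.1 hn
      obtain ⟨m', -, hm⟩ := mem_image.1 hn'
      have h0 := congrFun hm 0
      simp only [Fin.cons_zero] at h0
      rw [mem_coe, HasAntidiagonal.mem_antidiagonal] at hu hv
      ext <;> omega

theorem exists_le_sum_eq (r : ℕ) (b : Fin r → ℕ) (N : ℕ) (hN : N ≤ ∑ k, b k) :
    ∃ n : Fin r → ℕ, (∀ k, n k ≤ b k) ∧ ∑ k, n k = N := by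
  induction r generalizing N with
  | zero => exact ⟨b, fun _ => le_rfl, by simp at hN ⊢; omega⟩
  | succ r ih =>
    rw [Fin.sum_univ_succ] at hN
    obtain ⟨n, hn, hs⟩ := ih (fun k => b k.succ) (N - min N (b 0)) (by omega)
    refine ⟨Fin.cons (min N (b 0)) n, fun k => ?_, ?_⟩
    · refine Fin.cases ?_ (fun i => ?_) k
      · simp
      · simpa using hn i
    · rw [Fin.sum_univ_succ]
      simp only [Fin.cons_zero, Fin.cons_succ, hs]
      omega

/-- Taking the `u^t` coefficient of the `z^N` coefficient of `G(z) (1 + (y + u) z)^m`. -/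
theorem coeff_coeff_map_mul {R : Type*} [CommRing R] (G : Polynomial R) (y : R) (m N t : ℕ)
    (htN : t ≤ N) (htm : t ≤ m) :
    ((G.map Polynomial.C *
      (1 + Polynomial.C (Polynomial.C y + Polynomial.X) * Polynomial.X) ^ m).coeff N).coeff t =
      (m.choose t : R) * (G * (1 + Polynomial.C y * Polynomial.X) ^ (m - t)).coeff (N - t) := by
  have h : (1 + Polynomial.C (Polynomial.C y + Polynomial.X) * Polynomial.X :
      Polynomial (Polynomial R)) = Polynomial.C Polynomial.X * Polynomial.X +
        (1 + Polynomial.C y * Polynomial.X : Polynomial R).map Polynomial.C := by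
    simp only [Polynomial.map_add, Polynomial.map_mul, Polynomial.map_one, Polynomial.map_C,
      Polynomial.map_X, map_add]
    ring
  have hterm (j : ℕ) : G.map Polynomial.C * ((Polynomial.C Polynomial.X * Polynomial.X) ^ j *
      (1 + Polynomial.C y * Polynomial.X : Polynomial R).map Polynomial.C ^ (m - j) *
        (m.choose j : Polynomial (Polynomial R))) =
      Polynomial.C (Polynomial.X ^ j) *
        (((m.choose j : Polynomial R) * (G * (1 + Polynomial.C y * Polynomial.X) ^ (m - j))).map Polynomial.C *
          Polynomial.X ^ j) := by
    simp only [Polynomial.map_mul, Polynomial.map_pow, Polynomial.map_natCast, map_pow]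
    ring
  rw [h, add_pow, Finset.mul_sum, Polynomial.finsetSum_coeff, Polynomial.finsetSum_coeff,
    Finset.sum_eq_single t]
  · rw [hterm, Polynomial.coeff_C_mul, Polynomial.coeff_mul_X_pow', if_pos htN,
      Polynomial.coeff_map, Polynomial.coeff_X_pow_mul', if_pos le_rfl, Nat.sub_self,
      Polynomial.coeff_C_zero, ← Polynomial.C_eq_natCast, Polynomial.coeff_C_mul]
  · intro j _ hj
    rw [hterm, Polynomial.coeff_C_mul, Polynomial.coeff_mul_X_pow']
    split_ifs
    · rw [Polynomial.coeff_map, Polynomial.coeff_X_pow_mul']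
      split_ifs
      · exact Polynomial.coeff_C_of_ne_zero (by omega)
      · rfl
    · simp
  · intro ht
    exact absurd (Finset.mem_range.2 (by omega)) ht

theorem substLast_Fpoly (p s : ℕ) (b : Fin (s + 2) → ℕ) (N : ℕ) :
    substLast p s (Fpoly p b N) =
      (((∏ k : Fin (s + 1), (1 + Polynomial.C (MvPolynomial.X k.castSucc) * Polynomial.X) ^
          b k.castSucc : Polynomial (MvPolynomial (Fin (s + 2)) (ZMod p))).map Polynomial.C *
        (1 + Polynomial.C (Polynomial.C (MvPolynomial.X (Fin.last s).castSucc) + Polynomial.X) *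
          Polynomial.X) ^ b (Fin.last (s + 1)))).coeff N := by
  have h := sum_antidiagonalTuple_choose (A := Polynomial (MvPolynomial (Fin (s + 2)) (ZMod p)))
    (s + 2) N b
    (fun i => if i = Fin.last (s + 1)
      then Polynomial.C (MvPolynomial.X (Fin.castSucc (Fin.last s)) :
        MvPolynomial (Fin (s + 2)) (ZMod p)) + Polynomial.X
      else Polynomial.C (MvPolynomial.X i))
  rw [Fin.prod_univ_castSucc (n := s + 1)] at h
  simp only [if_true, Fin.castSucc_ne_last, if_false] at h
  rw [Polynomial.map_prod]
  simp only [Polynomial.map_pow, Polynomial.map_add, Polynomial.map_mul, Polynomial.map_one,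
    Polynomial.map_C, Polynomial.map_X]
  rw [← h, Fpoly, map_sum]
  refine Finset.sum_congr rfl fun n _ => ?_
  simp only [substLast, map_mul, map_prod, map_pow, MvPolynomial.aeval_X, map_natCast,
    Finset.prod_mul_distrib]

theorem coeff_prod_one_add_X {p s : ℕ} (c : Fin (s + 1) → ℕ) (M : ℕ) (d : Fin (s + 2) →₀ ℕ) :
    MvPolynomial.coeff d ((∏ k : Fin (s + 1),
      (1 + Polynomial.C (MvPolynomial.X k.castSucc) * Polynomial.X) ^ c k :
        Polynomial (MvPolynomial (Fin (s + 2)) (ZMod p))).coeff M) =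
      ∑ n ∈ Finset.Nat.antidiagonalTuple (s + 1) M,
        if Finsupp.equivFunOnFinite.symm (Fin.snoc n 0 : Fin (s + 2) → ℕ) = d then
          ∏ k, ((c k).choose (n k) : ZMod p) else 0 := by
  rw [← sum_antidiagonalTuple_choose, MvPolynomial.coeff_sum]
  refine Finset.sum_congr rfl fun n _ => ?_
  rw [← MvPolynomial.coeff_monomial, MvPolynomial.monomial_eq, Finsupp.prod_fintype _ _ (by simp),
    Fin.prod_univ_castSucc (n := s + 1), Finset.prod_mul_distrib]
  simp

/-- Lemma `entry of phi` (computational content): with `b_k ≤ p-1` for all `k`,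
`t = max(0, b_{r-1} + b_r - (p-1))` and `t ≤ N ≤ ∑ b_k`, the polynomial
`(∂^t Q/∂x^t)(0) ∈ F_p[x₁,…,x_{r-1}]` is not identically zero, and every monomial occurring
in it with nonzero coefficient has degree at most `p-1` in each variable `x₁,…,x_{r-1}`. -/
theorem stmt_3 (p : ℕ) (hp : p.Prime) (s : ℕ) (b : Fin (s + 2) → ℕ)
    (hb : ∀ k, b k ≤ p - 1) (N : ℕ)
    (htN : b (Fin.castSucc (Fin.last s)) + b (Fin.last (s + 1)) - (p - 1) ≤ N)
    (hN : N ≤ ∑ k, b k) :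
    let t := b (Fin.castSucc (Fin.last s)) + b (Fin.last (s + 1)) - (p - 1)
    let P := Polynomial.eval 0 ((⇑Polynomial.derivative)^[t] (substLast p s (Fpoly p b N)))
    P ≠ 0 ∧
      ∀ d : Fin (s + 2) →₀ ℕ, MvPolynomial.coeff d P ≠ 0 →
        ∀ i : Fin (s + 1), d (Fin.castSucc i) ≤ p - 1 := by
  intro t P
  have : Fact p.Prime := ⟨hp⟩
  have hp1 := hp.one_lt
  have hb1 := hb (Fin.last s).castSucc
  have hb2 := hb (Fin.last (s + 1))
  have ht : t = b (Fin.castSucc (Fin.last s)) + b (Fin.last (s + 1)) - (p - 1) := rfl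
  have choose_ne_zero {m n : ℕ} (hm : m ≤ p - 1) (hn : n ≤ m) : (m.choose n : ZMod p) ≠ 0 := by
    rw [Ne, ZMod.natCast_eq_zero_iff]
    intro h
    have h' := h.trans ⟨_, (Nat.choose_mul_factorial_mul_factorial hn).symm.trans (mul_assoc _ _ _)⟩
    have := (hp.dvd_factorial).1 h'
    omega
  set c : Fin (s + 1) → ℕ := Fin.snoc (fun k : Fin s => b k.castSucc.castSucc)
    (b (Fin.last s).castSucc + (b (Fin.last (s + 1)) - t)) with hc
  have hcp (k) : c k ≤ p - 1 := by
    refine Fin.lastCases ?_ (fun i => ?_) k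
    · simp only [hc, Fin.snoc_last]; omega
    · simpa only [hc, Fin.snoc_castSucc] using hb _
  have hcN : N - t ≤ ∑ k, c k := by
    rw [Fin.sum_univ_castSucc, Fin.sum_univ_castSucc] at hN
    rw [Fin.sum_univ_castSucc]
    simp only [hc, Fin.snoc_last, Fin.snoc_castSucc]
    omega
  have hP : P = MvPolynomial.C
      ((t.factorial : ZMod p) * ((b (Fin.last (s + 1))).choose t : ZMod p)) *
      (∏ k : Fin (s + 1), (1 + Polynomial.C (MvPolynomial.X k.castSucc) * Polynomial.X) ^ c k :
        Polynomial (MvPolynomial (Fin (s + 2)) (ZMod p))).coeff (N - t) := by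
    simp only [P]
    rw [← Polynomial.coeff_zero_eq_eval_zero, Polynomial.coeff_iterate_derivative, zero_add,
      Nat.descFactorial_self, substLast_Fpoly,
      coeff_coeff_map_mul _ _ _ _ t htN (by omega), Fin.prod_univ_castSucc (n := s),
      Fin.prod_univ_castSucc (n := s), mul_assoc (Finset.prod _ _), ← pow_add]
    simp only [hc, Fin.snoc_last, Fin.snoc_castSucc, nsmul_eq_mul, map_mul, map_natCast, mul_assoc]
  have hPd (d) := (congrArg (MvPolynomial.coeff d) hP).trans
    ((MvPolynomial.coeff_C_mul _ _ _).trans (congrArg _ (coeff_prod_one_add_X c (N - t) d)))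
  refine ⟨fun h0 => ?_, fun d hd i => ?_⟩
  · obtain ⟨n, hn, hs⟩ := exists_le_sum_eq _ c _ hcN
    have h := hPd (Finsupp.equivFunOnFinite.symm (Fin.snoc n 0 : Fin (s + 2) → ℕ))
    rw [h0, MvPolynomial.coeff_zero, Finset.sum_eq_single n, if_pos rfl] at h
    · refine mul_ne_zero (mul_ne_zero ?_ (choose_ne_zero hb2 (by omega)))
        (Finset.prod_ne_zero_iff.2 fun k _ => choose_ne_zero (hcp k) (hn k)) h.symm
      rw [Ne, ZMod.natCast_eq_zero_iff, hp.dvd_factorial]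
      omega
    · intro m _ hm
      refine if_neg fun h => hm ?_
      exact (Fin.snoc_injective2 (Finsupp.equivFunOnFinite.symm.injective h)).1
    · intro h
      exact absurd (Finset.Nat.mem_antidiagonalTuple.2 hs) h
  · rw [hPd] at hd
    obtain ⟨n, -, hn⟩ := Finset.exists_ne_zero_of_sum_ne_zero (right_ne_zero_of_mul hd)
    obtain ⟨rfl, hne⟩ := ite_ne_right_iff.1 hn
    have hi := Finset.prod_ne_zero_iff.1 hne i (Finset.mem_univ i)
    have hle : n i ≤ c i := by
      by_contra! hlt
      exact hi (by rw [Nat.choose_eq_zero_of_lt hlt, Nat.cast_zero])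
    simpa using hle.trans (hcp i)
end

section
/- Let p be a prime and c, d natural numbers with c ≥ d ≥ p. Then in ℤ/pℤ one has C(c,d) · ⌊d/p⌋ = C(c, d−p) · (1 + ⌊(c−d)/p⌋), where C(·,·) denotes the binomial coefficient reduced modulo p and the floor quotients are reduced modulo p; i.e. C(c,d) ≡ C(c,d−p) · (1+⌊(c−d)/p⌋)/⌊d/p⌋ (mod p) whenever ⌊d/p⌋ is invertible modulo p. -/
/-- Lucas' theorem as an identity in `ZMod p`. -/
theorem natCast_choose_eq_choose_mod_mul_choose_div {p : ℕ} (hp : p.Prime) (n k : ℕ) :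
    (n.choose k : ZMod p) =
      ((n % p).choose (k % p) : ZMod p) * ((n / p).choose (k / p) : ZMod p) := by
  have := Fact.mk hp
  exact_mod_cast (ZMod.natCast_eq_natCast_iff _ _ _).2
    (Choose.choose_modEq_choose_mod_mul_choose_div_nat (p := p) (n := n) (k := k))

/-- Lemma `choose p less`: for a prime `p` and naturals `c ≥ d ≥ p`, in `ℤ/pℤ` one has
`C(c,d) · ⌊d/p⌋ = C(c, d-p) · (1 + ⌊(c-d)/p⌋)`. -/
theorem stmt_4 (p : ℕ) (hp : p.Prime) (c d : ℕ) (hdc : d ≤ c) (hpd : p ≤ d) :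
    (c.choose d : ZMod p) * ((d / p : ℕ) : ZMod p)
      = (c.choose (d - p) : ZMod p) * (1 + (((c - d) / p : ℕ) : ZMod p)) := by
  obtain ⟨e, rfl⟩ := Nat.exists_eq_add_of_le' hpd
  rw [natCast_choose_eq_choose_mod_mul_choose_div hp c (e + p),
    natCast_choose_eq_choose_mod_mul_choose_div hp c (e + p - p), Nat.add_sub_cancel,
    Nat.add_mod_right, Nat.add_div_right _ hp.pos]
  rcases lt_or_ge (c % p) (e % p) with h | h
  · simp [Nat.choose_eq_zero_of_lt h]
  · have hle : e / p + 1 ≤ c / p := by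
      simpa [Nat.add_div_right _ hp.pos] using Nat.div_le_div_right (c := p) hdc
    have hdiv : (c - (e + p)) / p = c / p - (e / p + 1) := by
      have hc : c - (e + p) = (c % p - e % p) + p * (c / p - (e / p + 1)) := by
        have h₁ := Nat.mod_add_div c p
        have h₂ := Nat.mod_add_div e p
        obtain ⟨m, hm⟩ := Nat.exists_eq_add_of_le hle
        rw [hm] at h₁ ⊢
        rw [Nat.add_sub_cancel_left]
        simp only [mul_add, mul_one] at h₁
        omega
      rw [hc, Nat.add_mul_div_left _ _ hp.pos,
        Nat.div_eq_of_lt ((Nat.sub_le _ _).trans_lt (Nat.mod_lt _ hp.pos)), zero_add]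
    have key := Nat.choose_succ_right_eq (c / p) (e / p)
    rw [show c / p - e / p = 1 + (c - (e + p)) / p by omega] at key
    rw [mul_assoc, mul_assoc]
    congr 1
    exact_mod_cast congrArg (Nat.cast (R := ZMod p)) key
end

section
/- Let m and r be integers with r ≥ 4. Let b₁,…,b_r be integers with 1 ≤ b_k ≤ m−1 for every k and b₁ + ⋯ + b_r = m. Then there exists an integer T with 2 ≤ T ≤ m−2 such that ∑_{k=1}^r ((T·b_k) mod m) = 2m and the number of indices k with T·b_k not divisible by m is at least 4. -/
/-- Proposition `sig 0 then 1` (arithmetic content, cyclic case): given integers `m`, `r ≥ 4`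
and `b₁,…,b_r` with `1 ≤ b_k ≤ m-1` and `∑ b_k = m`, there exists `2 ≤ T ≤ m-2` with
`∑_k ((T·b_k) mod m) = 2m` and at least `4` indices `k` for which `m ∤ T·b_k`. -/
theorem stmt_5 (m r : ℕ) (hr : 4 ≤ r) (b : Fin r → ℕ)
    (hb : ∀ k, 1 ≤ b k ∧ b k ≤ m - 1) (hsum : ∑ k, b k = m) :
    ∃ T : ℕ, 2 ≤ T ∧ T ≤ m - 2 ∧ (∑ k, (T * b k) % m) = 2 * m ∧
      4 ≤ (Finset.univ.filter (fun k : Fin r => ¬ (m ∣ T * b k))).card := by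
  have hm : 4 ≤ m := by
    have h : ∑ _k : Fin r, 1 ≤ ∑ k, b k := Finset.sum_le_sum fun k _ => (hb k).1
    simp only [Finset.sum_const, Finset.card_univ, Fintype.card_fin, smul_eq_mul, mul_one] at h
    omega
  have hdvd : ∀ T, m ∣ ∑ k, (T * b k) % m := fun T => by
    rw [Nat.dvd_iff_mod_eq_zero, ← Finset.sum_nat_mod, ← Finset.mul_sum, hsum,
      Nat.mul_mod_left]
  have hlast : (∑ k, ((m - 1) * b k) % m) + m = r * m := by
    have hterm : ∀ k, ((m - 1) * b k) % m + b k = m := fun k => by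
      obtain ⟨h1, h2⟩ := hb k
      have h : (m - 1) * b k = (m - b k) + m * (b k - 1) := by
        zify [show 1 ≤ m by omega, show b k ≤ m by omega, h1]
        ring
      rw [h, Nat.add_mul_mod_self_left, Nat.mod_eq_of_lt (by omega)]
      omega
    calc (∑ k, ((m - 1) * b k) % m) + m
        = ∑ k, (((m - 1) * b k) % m + b k) := by rw [Finset.sum_add_distrib, hsum]
      _ = r * m := by simp [hterm]
  have hex : ∃ T, 2 * m ≤ ∑ k, (T * b k) % m := ⟨m - 1, by nlinarith⟩
  obtain ⟨T, hT, hmin⟩ : ∃ T, 2 * m ≤ ∑ k, (T * b k) % m ∧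
      ∀ t < T, ¬ 2 * m ≤ ∑ k, (t * b k) % m :=
    ⟨Nat.find hex, Nat.find_spec hex, fun t ht => Nat.find_min hex ht⟩
  have hT0 : T ≠ 0 := by
    rintro rfl
    simp at hT
    omega
  have hT1 : T ≠ 1 := by
    rintro rfl
    have h : ∑ k, (1 * b k) % m ≤ ∑ k, b k :=
      Finset.sum_le_sum fun k _ => by simpa using Nat.mod_le (b k) m
    omega
  obtain ⟨t, rfl⟩ := Nat.exists_eq_succ_of_ne_zero hT0
  have hprev : ∑ k, (t * b k) % m ≤ m := by
    have h := hmin t (Nat.lt_succ_self t)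
    obtain ⟨c, hc⟩ := hdvd t
    rw [hc] at h ⊢
    have : c < 2 := by
      by_contra! hc2
      nlinarith
    nlinarith
  have hle : ∀ k ∈ Finset.univ, (t.succ * b k) % m ≤ (t * b k) % m + b k := fun k _ => by
    rw [Nat.succ_mul, ← Nat.mod_add_mod]
    exact Nat.mod_le _ _
  have htotal : ∑ k, ((t * b k) % m + b k) ≤ 2 * m := by
    rw [Finset.sum_add_distrib, hsum]
    omega
  have hsumle := Finset.sum_le_sum hle
  have hterm := (Finset.sum_eq_sum_iff_of_le hle).1 (by omega)
  have htwo : ∑ k, (t.succ * b k) % m = 2 * m := by omega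
  refine ⟨t.succ, by omega, ?_, htwo, ?_⟩
  · by_contra! hlt
    have hne : t.succ ≠ m - 1 := fun h => by
      rw [h] at htwo
      nlinarith
    exact hmin (m - 1) (by omega) (by nlinarith)
  · rw [Finset.filter_true_of_mem, Finset.card_univ, Fintype.card_fin]
    · exact hr
    · intro k hk hd
      have h1 := hterm k hk
      rw [Nat.mod_eq_zero_of_dvd hd] at h1
      have h2 := (hb k).1
      omega
end

section
/- Let p be a prime and b₂, b₃, b₄, a, i nonnegative integers with 1 ≤ i ≤ a and a ≡ b₂ + b₃ + b₄ (mod p). Then in ℤ/pℤ the following identity holds: b₂·C(b₂−1, i)·C(b₃, a−i) + b₃·C(b₂, i−1)·C(b₃−1, a−i+1) + b₄·C(b₂, i−1)·C(b₃, a−i+1) + b₄·C(b₂, i)·C(b₃, a−i) = −(a+1)·C(b₂, i)·C(b₃, a−i+1). -/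
/-- The absorption identity `(k + 1) C(n, k + 1) = (n - k) C(n, k)` in a commutative ring. -/
theorem cast_succ_mul_choose_succ {R : Type*} [CommRing R] (n k : ℕ) :
    ((k : R) + 1) * (n.choose (k + 1) : R) = ((n : R) - k) * (n.choose k : R) := by
  rcases le_or_gt k n with h | h
  · have := congrArg (Nat.cast : ℕ → R) (Nat.choose_succ_right_eq n k)
    push_cast [Nat.cast_sub h] at this
    linear_combination this
  · simp [Nat.choose_eq_zero_of_lt h, Nat.choose_eq_zero_of_lt (h.trans (Nat.lt_succ_self k))]

/-- The absorption identity `n C(n - 1, k) = (n - k) C(n, k)` in a commutative ring. -/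
theorem cast_mul_choose_pred {R : Type*} [CommRing R] (n k : ℕ) :
    (n : R) * ((n - 1).choose k : R) = ((n : R) - k) * (n.choose k : R) := by
  rcases n with _ | n
  · cases k <;> simp
  · have := congrArg (Nat.cast : ℕ → R) (Nat.add_one_mul_choose_eq n k)
    rw [← cast_succ_mul_choose_succ]
    push_cast at this ⊢
    simpa [mul_comm] using this


/-- The coefficient identity from the proof of Proposition `specialization of phi and psi`:
for a prime `p` and naturals `b₂, b₃, b₄, a, i` with `1 ≤ i ≤ a` and
`a ≡ b₂ + b₃ + b₄ (mod p)`, in `ℤ/pℤ` one has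
`b₂·C(b₂-1,i)·C(b₃,a-i) + b₃·C(b₂,i-1)·C(b₃-1,a-i+1) + b₄·C(b₂,i-1)·C(b₃,a-i+1)
  + b₄·C(b₂,i)·C(b₃,a-i) = -(a+1)·C(b₂,i)·C(b₃,a-i+1)`. -/
theorem stmt_6 (p : ℕ) (hp : p.Prime) (b₂ b₃ b₄ a i : ℕ)
    (hi1 : 1 ≤ i) (hia : i ≤ a) (hcong : (a : ZMod p) = ((b₂ + b₃ + b₄ : ℕ) : ZMod p)) :
    (b₂ : ZMod p) * ((b₂ - 1).choose i : ZMod p) * (b₃.choose (a - i) : ZMod p)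
      + (b₃ : ZMod p) * (b₂.choose (i - 1) : ZMod p) * ((b₃ - 1).choose (a - i + 1) : ZMod p)
      + (b₄ : ZMod p) * (b₂.choose (i - 1) : ZMod p) * (b₃.choose (a - i + 1) : ZMod p)
      + (b₄ : ZMod p) * (b₂.choose i : ZMod p) * (b₃.choose (a - i) : ZMod p)
    = -((a : ZMod p) + 1) * (b₂.choose i : ZMod p) * (b₃.choose (a - i + 1) : ZMod p) := by
  obtain ⟨k, rfl⟩ := Nat.exists_eq_add_of_le' hi1
  obtain ⟨m, rfl⟩ := Nat.exists_eq_add_of_le hia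
  have h₂ := cast_mul_choose_pred (R := ZMod p) b₂ (k + 1)
  have h₃ := cast_mul_choose_pred (R := ZMod p) b₃ (m + 1)
  have e₂ := cast_succ_mul_choose_succ (R := ZMod p) b₂ k
  have e₃ := cast_succ_mul_choose_succ (R := ZMod p) b₃ m
  rw [Nat.add_sub_cancel_left, Nat.add_sub_cancel]
  push_cast at h₂ h₃ hcong ⊢
  linear_combination (b₃.choose m : ZMod p) * h₂ + (b₂.choose k : ZMod p) * h₃
    + (b₃.choose (m + 1) : ZMod p) * e₂ + (b₂.choose (k + 1) : ZMod p) * e₃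
    - ((b₂.choose k : ZMod p) * (b₃.choose (m + 1) : ZMod p)
      + (b₂.choose (k + 1) : ZMod p) * (b₃.choose m : ZMod p)) * hcong
end

section
/- Let p be a prime and a, b, c nonnegative integers with a ≤ p−1, b ≤ p−1, and c ≤ a+b. Then: (1) the degree of f(a,b,c) equals min(a,c); (2) the multiplicity of 0 as a root of f(a,b,c) equals max(0, c−b); (3) the multiplicity of 1 as a root of f(a,b,c) equals a+b−(p−1) if a+b−(p−1) ≤ c ≤ p−1 < a+b, and equals 0 otherwise. -/
/-- `fabc p a b c = ∑_{i+j=c} C(a,i)·C(b,j)·t^i` in `F_p[t]`. -/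
noncomputable def fabc (p a b c : ℕ) : Polynomial (ZMod p) :=
  ∑ i ∈ Finset.range (c + 1),
    Polynomial.C ((a.choose i : ZMod p) * (b.choose (c - i) : ZMod p)) * Polynomial.X ^ i

theorem fabc_coeff (p a b c i : ℕ) :
    (fabc p a b c).coeff i =
      if i ≤ c then (a.choose i : ZMod p) * (b.choose (c - i) : ZMod p) else 0 := by
  simp only [fabc, Polynomial.finsetSum_coeff, Polynomial.coeff_C_mul_X_pow]
  rw [Finset.sum_ite_eq]
  simp

theorem ZMod.choose_ne_zero_of_lt {p n k : ℕ} (hp : p.Prime) (hn : n < p) (hk : k ≤ n) :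
    (n.choose k : ZMod p) ≠ 0 := by
  rw [Ne, ZMod.natCast_eq_zero_iff]
  intro h
  have hdvd : p ∣ n.factorial := by
    rw [← Nat.choose_mul_factorial_mul_factorial hk]
    exact (h.mul_right _).mul_right _
  exact absurd ((hp.dvd_factorial).1 hdvd) (by lia)

theorem ZMod.choose_self_add {p s k : ℕ} (hp : p.Prime) (hs : s < p) (hk : k < p) :
    ((p + s).choose k : ZMod p) = (s.choose k : ZMod p) := by
  have : Fact p.Prime := ⟨hp⟩
  have h := Choose.choose_modEq_choose_mod_mul_choose_div_nat (n := p + s) (k := k) (p := p)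
  rw [Nat.mod_eq_of_lt hk, Nat.div_eq_of_lt hk, Nat.add_mod_left, Nat.mod_eq_of_lt hs,
    Nat.choose_zero_right, mul_one] at h
  exact (ZMod.natCast_eq_natCast_iff _ _ _).2 h

theorem Nat.sum_range_choose_mul_choose_mul_choose {a b c k : ℕ} (hka : k ≤ a) (hkc : k ≤ c) :
    ∑ i ∈ Finset.range (c + 1), a.choose i * b.choose (c - i) * i.choose k =
      a.choose k * (a + b - k).choose (c - k) := by
  obtain ⟨d, rfl⟩ := Nat.exists_eq_add_of_le hkc
  obtain ⟨e, rfl⟩ := Nat.exists_eq_add_of_le hka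
  rw [add_assoc, Finset.sum_range_add, Finset.sum_eq_zero, zero_add,
    show k + e + b - k = e + b by lia, Nat.add_sub_cancel_left, Nat.add_choose_eq e b d,
    Finset.Nat.sum_antidiagonal_eq_sum_range_succ (fun i j => e.choose i * b.choose j),
    Finset.mul_sum]
  · refine Finset.sum_congr rfl fun i _ => ?_
    have h := Nat.choose_mul (n := k + e) (k := k + i) (s := k) (by lia)
    rw [Nat.add_sub_cancel_left, Nat.add_sub_cancel_left] at h
    rw [Nat.add_sub_add_left, mul_right_comm, h, mul_assoc]
  · intro i hi
    rw [Nat.choose_eq_zero_of_lt (Finset.mem_range.1 hi), mul_zero]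

theorem fabc_comp_coeff {p a b c k : ℕ} (hka : k ≤ a) (hkc : k ≤ c) :
    ((fabc p a b c).comp (Polynomial.X + Polynomial.C 1)).coeff k =
      (a.choose k : ZMod p) * ((a + b - k).choose (c - k) : ZMod p) := by
  rw [← Nat.cast_mul, ← Nat.sum_range_choose_mul_choose_mul_choose hka hkc, fabc,
    Polynomial.sum_comp, Polynomial.finsetSum_coeff, Nat.cast_sum]
  refine Finset.sum_congr rfl fun i _ => ?_
  rw [Polynomial.mul_comp, Polynomial.C_comp, Polynomial.X_pow_comp, Polynomial.coeff_C_mul,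
    Polynomial.C_1, Polynomial.coeff_X_add_one_pow]
  push_cast
  rfl

theorem Polynomial.natTrailingDegree_eq_of_coeff {R : Type*} [Semiring R] {f : Polynomial R}
    {n : ℕ} (hn : f.coeff n ≠ 0) (h : ∀ k < n, f.coeff k = 0) : f.natTrailingDegree = n :=
  le_antisymm (natTrailingDegree_le_of_ne_zero hn)
    (le_natTrailingDegree (by rintro rfl; simp at hn) h)

/-- Lemma `deg, vt and vt-1 of fabc`: for `a, b ≤ p-1` and `c ≤ a+b`,
(1) `deg f(a,b,c) = min(a,c)`; (2) the multiplicity of `0` as a root of `f(a,b,c)` equals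
`max(0, c-b)`; (3) the multiplicity of `1` as a root equals `a+b-(p-1)` if
`a+b-(p-1) ≤ c ≤ p-1 < a+b`, and `0` otherwise. -/
theorem stmt_7 (p : ℕ) (hp : p.Prime) (a b c : ℕ)
    (ha : a ≤ p - 1) (hb : b ≤ p - 1) (hc : c ≤ a + b) :
    (fabc p a b c).natDegree = min a c ∧
    Polynomial.rootMultiplicity 0 (fabc p a b c) = c - b ∧
    Polynomial.rootMultiplicity 1 (fabc p a b c)
      = if a + b - (p - 1) ≤ c ∧ c ≤ p - 1 ∧ p - 1 < a + b then a + b - (p - 1) else 0 := by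
  have : Fact p.Prime := ⟨hp⟩
  have hpos := hp.pos
  have hne (i : ℕ) (hia : i ≤ a) (hic : i ≤ c) (hib : c - i ≤ b) :
      (fabc p a b c).coeff i ≠ 0 := by
    rw [fabc_coeff, if_pos hic]
    exact mul_ne_zero (ZMod.choose_ne_zero_of_lt hp (by lia) hia)
      (ZMod.choose_ne_zero_of_lt hp (by lia) hib)
  refine ⟨?_, ?_, ?_⟩
  · refine Polynomial.natDegree_eq_of_le_of_coeff_ne_zero
      (Polynomial.natDegree_le_iff_coeff_eq_zero.2 fun i hi => ?_)
      (hne _ (min_le_left _ _) (min_le_right _ _) (by lia))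
    rw [fabc_coeff]
    split_ifs with hic
    · rw [Nat.choose_eq_zero_of_lt (show a < i by lia), Nat.cast_zero, zero_mul]
    · rfl
  · rw [Polynomial.rootMultiplicity_eq_natTrailingDegree']
    refine Polynomial.natTrailingDegree_eq_of_coeff
      (hne _ (by lia) (by lia) (by lia)) fun i hi => ?_
    rw [fabc_coeff, if_pos (by lia), Nat.choose_eq_zero_of_lt (show b < c - i by lia),
      Nat.cast_zero, mul_zero]
  · rw [Polynomial.rootMultiplicity_eq_natTrailingDegree]
    split_ifs with h
    · obtain ⟨hmc, hcp, hab⟩ := h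
      refine Polynomial.natTrailingDegree_eq_of_coeff ?_ fun k hk => ?_
      · rw [fabc_comp_coeff (by lia) hmc]
        exact mul_ne_zero (ZMod.choose_ne_zero_of_lt hp (by lia) (by lia))
          (ZMod.choose_ne_zero_of_lt hp (by lia) (by lia))
      · rw [fabc_comp_coeff (by lia) (by lia), show a + b - k = p + (a + b - k - p) by lia,
          ZMod.choose_self_add hp (by lia) (by lia),
          Nat.choose_eq_zero_of_lt (show a + b - k - p < c - k by lia),
          Nat.cast_zero, mul_zero]
    · refine Polynomial.natTrailingDegree_eq_of_coeff ?_ (by simp)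
      rw [fabc_comp_coeff (Nat.zero_le _) (Nat.zero_le _), Nat.choose_zero_right, Nat.cast_one,
        one_mul, Nat.sub_zero, Nat.sub_zero]
      by_cases hab : a + b < p
      · exact ZMod.choose_ne_zero_of_lt hp hab hc
      · obtain ⟨s, hs⟩ := Nat.exists_eq_add_of_le (not_lt.1 hab)
        rw [hs]
        by_cases hcp : c < p
        · rw [ZMod.choose_self_add hp (by lia) hcp]
          exact ZMod.choose_ne_zero_of_lt hp (by lia) (by lia)
        · rw [← Nat.choose_symm (by lia), ZMod.choose_self_add hp (by lia) (by lia)]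
          exact ZMod.choose_ne_zero_of_lt hp (by lia) (by lia)
end

section
/- Let p be a prime and a, b, c nonnegative integers. Then in F_p[t]: (1) if c ≥ 1, f(a,b,c) + f(a,b,c−1) = f(a,b+1,c); (2) if c ≥ 1, f(a,b,c) + t·f(a,b,c−1) = f(a+1,b,c); (3) if c ≥ 1, f(a+1,b,c) − f(a,b+1,c) = (t−1)·f(a,b,c−1); (4) if c ≤ a+b, C(a+b,a)·f(a,b,c) = C(a+b,c)·f(c, a+b−c, a). -/
theorem coeff_fabc (p a b c k : ℕ) :
    (fabc p a b c).coeff k =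
      if k ≤ c then (a.choose k : ZMod p) * (b.choose (c - k) : ZMod p) else 0 := by
  simp only [fabc, Polynomial.finsetSum_coeff, Polynomial.coeff_C_mul, Polynomial.coeff_X_pow,
    mul_ite, mul_one, mul_zero, Finset.sum_ite_eq, Finset.mem_range, Nat.lt_succ_iff]

theorem fabc_add_fabc_eq_fabc_succ_right (p a b c : ℕ) :
    fabc p a b (c + 1) + fabc p a b c = fabc p a (b + 1) (c + 1) := by
  ext k
  simp only [Polynomial.coeff_add, coeff_fabc]
  rcases lt_trichotomy k (c + 1) with h | rfl | h
  · have hk : c + 1 - k = (c - k) + 1 := by omega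
    rw [if_pos h.le, if_pos (Nat.lt_succ_iff.mp h), if_pos h.le, hk, Nat.choose_succ_succ]
    push_cast
    ring
  · simp
  · rw [if_neg (by omega), if_neg (by omega), if_neg (by omega), add_zero]

theorem fabc_add_X_mul_fabc_eq_fabc_succ_left (p a b c : ℕ) :
    fabc p a b (c + 1) + Polynomial.X * fabc p a b c = fabc p (a + 1) b (c + 1) := by
  ext k
  cases k with
  | zero => simp [coeff_fabc]
  | succ k =>
    simp only [Polynomial.coeff_add, Polynomial.coeff_X_mul, coeff_fabc,
      Nat.add_le_add_iff_right, Nat.add_sub_add_right]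
    split_ifs
    · rw [Nat.choose_succ_succ]
      push_cast
      ring
    · simp

theorem choose_mul_choose_mul_choose_comm (k x y z : ℕ) :
    (k + x + (y + z)).choose (k + x) * ((k + x).choose k * (y + z).choose y) =
      (k + x + (y + z)).choose (k + y) * ((k + y).choose k * (x + z).choose x) := by
  have multinomial (u v : ℕ) :
      (k + u + (v + z)).choose (k + u) * ((k + u).choose k * (v + z).choose v) *
        (k.factorial * u.factorial * v.factorial * z.factorial) =
          (k + u + (v + z)).factorial := by
    rw [← Nat.add_choose_mul_factorial_mul_factorial (k + u) (v + z),
      ← Nat.add_choose_mul_factorial_mul_factorial k u,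
      ← Nat.add_choose_mul_factorial_mul_factorial v z,
      Nat.choose_symm_add (a := k + u), Nat.choose_symm_add (a := k),
      Nat.choose_symm_add (a := v)]
    ring
  have h₁ := multinomial x y
  have h₂ := multinomial y x
  rw [show k + y + (x + z) = k + x + (y + z) by ring] at h₂
  refine Nat.eq_of_mul_eq_mul_right
    (show 0 < k.factorial * x.factorial * y.factorial * z.factorial by positivity) ?_
  rw [h₁, ← h₂]
  ring

theorem choose_mul_fabc_comm (p a b c : ℕ) (h : c ≤ a + b) :
    Polynomial.C (((a + b).choose a : ZMod p)) * fabc p a b c =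
      Polynomial.C (((a + b).choose c : ZMod p)) * fabc p c (a + b - c) a := by
  ext k
  simp only [Polynomial.coeff_C_mul, coeff_fabc]
  by_cases hc : k ≤ c
  · by_cases ha : k ≤ a
    · rw [if_pos hc, if_pos ha]
      obtain ⟨x, rfl⟩ := Nat.exists_eq_add_of_le ha
      obtain ⟨y, rfl⟩ := Nat.exists_eq_add_of_le hc
      by_cases hy : y ≤ b
      · obtain ⟨z, rfl⟩ := Nat.exists_eq_add_of_le hy
        rw [show k + x + (y + z) - (k + y) = x + z by omega, Nat.add_sub_cancel_left,
          Nat.add_sub_cancel_left]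
        exact_mod_cast congrArg (Nat.cast (R := ZMod p))
          (choose_mul_choose_mul_choose_comm k x y z)
      · rw [Nat.choose_eq_zero_of_lt (show b < k + y - k by omega),
          Nat.choose_eq_zero_of_lt (show k + x + b - (k + y) < k + x - k by omega)]
        simp
    · rw [if_neg ha, Nat.choose_eq_zero_of_lt (not_le.mp ha)]
      simp
  · rw [if_neg hc, Nat.choose_eq_zero_of_lt (not_le.mp hc)]
    simp

/-- Lemma `rec / fabc involution`: in `F_p[t]`,
(1) `f(a,b,c) + f(a,b,c-1) = f(a,b+1,c)` for `c ≥ 1`;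
(2) `f(a,b,c) + t·f(a,b,c-1) = f(a+1,b,c)` for `c ≥ 1`;
(3) `f(a+1,b,c) - f(a,b+1,c) = (t-1)·f(a,b,c-1)` for `c ≥ 1`;
(4) `C(a+b,a)·f(a,b,c) = C(a+b,c)·f(c, a+b-c, a)` for `c ≤ a+b`. -/
theorem stmt_8 (p : ℕ) (hp : p.Prime) (a b c : ℕ) :
    (1 ≤ c → fabc p a b c + fabc p a b (c - 1) = fabc p a (b + 1) c) ∧
    (1 ≤ c → fabc p a b c + Polynomial.X * fabc p a b (c - 1) = fabc p (a + 1) b c) ∧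
    (1 ≤ c → fabc p (a + 1) b c - fabc p a (b + 1) c
        = (Polynomial.X - 1) * fabc p a b (c - 1)) ∧
    (c ≤ a + b → Polynomial.C (((a + b).choose a : ZMod p)) * fabc p a b c
        = Polynomial.C (((a + b).choose c : ZMod p)) * fabc p c (a + b - c) a) := by
  refine ⟨fun hc => ?_, fun hc => ?_, fun hc => ?_, choose_mul_fabc_comm p a b c⟩ <;>
    obtain ⟨c, rfl⟩ := Nat.exists_eq_add_of_le' hc <;>
    rw [Nat.add_sub_cancel]
  · exact fabc_add_fabc_eq_fabc_succ_right p a b c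
  · exact fabc_add_X_mul_fabc_eq_fabc_succ_left p a b c
  · rw [← fabc_add_fabc_eq_fabc_succ_right, ← fabc_add_X_mul_fabc_eq_fabc_succ_left]
    ring
end

section
/- Let p be a prime and a, b, c nonnegative integers. Then in F_p[t]: (1) if b ≤ c ≤ a+b, then f(a,b,c) = t^{c−b}·f(b, a, a+b−c); (2) if a ≤ p−1, b ≤ p−1, p−1 ≤ a+b, and a+b−(p−1) ≤ c ≤ p−1, then f(a,b,c) = (−1)^{a+c}·(t−1)^{a+b−(p−1)}·f(c−(a+b)+(p−1), (p−1)−c, (p−1)−b). -/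
open Polynomial in
theorem fabc_eq_coeff (p a b c : ℕ) :
    fabc p a b c =
      (((1 + C X * X) ^ a * (1 + X) ^ b : (ZMod p)[X][X])).coeff c := by
  have hcomp : ((1 + C X * X) ^ a : (ZMod p)[X][X]) = ((1 + X) ^ a).comp (C X * X) := by simp
  rw [coeff_mul, Finset.Nat.sum_antidiagonal_eq_sum_range_succ_mk, fabc]
  refine Finset.sum_congr rfl fun i _ => ?_
  rw [hcomp, comp_C_mul_X_coeff, coeff_one_add_X_pow, coeff_one_add_X_pow]
  simp only [map_mul, map_natCast]
  ring

open Polynomial in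
/-- Expansion of `fabc` in powers of `X - 1`. -/
theorem fabc_eq_sum_X_sub_one (p a b c : ℕ) :
    fabc p a b c = ∑ k ∈ Finset.range (min a c + 1),
      ((a.choose k * (a + b - k).choose (c - k) : ℕ) : (ZMod p)[X]) * (X - 1) ^ k := by
  have hsplit : (1 + C X * X : (ZMod p)[X][X]) = C (X - 1) * X + (1 + X) := by
    simp only [map_sub, map_one]
    ring
  have hterm : ∀ k ∈ Finset.range (a + 1),
      (((C (X - 1) * X) ^ k * (1 + X) ^ (a - k) * (a.choose k : (ZMod p)[X][X])) *
        (1 + X) ^ b).coeff c =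
      if k ≤ c then
        ((a.choose k * (a + b - k).choose (c - k) : ℕ) : (ZMod p)[X]) * (X - 1) ^ k
      else 0 := by
    intro k hk
    have hk' : a + b - k = a - k + b := by
      have := Finset.mem_range.mp hk
      omega
    have hfactor : ((C (X - 1) * X) ^ k * (1 + X) ^ (a - k) * (a.choose k : (ZMod p)[X][X])) *
        (1 + X) ^ b =
        C ((a.choose k : (ZMod p)[X]) * (X - 1) ^ k) * ((1 + X) ^ (a - k + b) * X ^ k) := by
      simp only [map_mul, map_natCast, map_pow]
      ring
    rw [hfactor, coeff_C_mul, coeff_mul_X_pow', coeff_one_add_X_pow, hk']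
    split_ifs
    · push_cast
      ring
    · simp
  rw [fabc_eq_coeff, hsplit, add_pow, Finset.sum_mul, finsetSum_coeff,
    Finset.sum_congr rfl hterm, ← Finset.sum_filter]
  refine Finset.sum_congr ?_ fun _ _ => rfl
  ext k
  simp only [Finset.mem_filter, Finset.mem_range]
  omega

theorem ZMod.natCast_choose_pred_sub (p : ℕ) [Fact p.Prime] (l m : ℕ) (h : l + m ≤ p - 1) :
    (((p - 1 - l).choose m : ℕ) : ZMod p) = (-1) ^ m * ((l + m).choose m : ℕ) := by
  have hp : 1 ≤ p := (Fact.out : p.Prime).one_le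
  induction m with
  | zero => simp
  | succ m ih =>
    have hm : ((m + 1 : ℕ) : ZMod p) ≠ 0 := by
      rw [Ne, ZMod.natCast_eq_zero_iff]
      exact fun hd => absurd (Nat.le_of_dvd m.succ_pos hd) (by omega)
    have hleft := congrArg (Nat.cast (R := ZMod p)) (Nat.choose_succ_right_eq (p - 1 - l) m)
    have hright := congrArg (Nat.cast (R := ZMod p)) (Nat.add_one_mul_choose_eq (l + m) m)
    have hsub : ((p - 1 - l - m : ℕ) : ZMod p) = -(l + m + 1) := by
      rw [show p - 1 - l - m = p - (l + m + 1) by omega, Nat.cast_sub (by omega)]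
      simp
    rw [Nat.cast_mul, Nat.cast_mul, hsub, ih (by omega)] at hleft
    apply mul_right_cancel₀ hm
    rw [hleft, ← add_assoc, pow_succ]
    push_cast at hright ⊢
    linear_combination (-(-1) ^ m) * hright

theorem fabc_eq_X_pow_mul (p : ℕ) {a b c : ℕ} (hbc : b ≤ c) (hc : c ≤ a + b) :
    fabc p a b c = Polynomial.X ^ (c - b) * fabc p b a (a + b - c) := by
  have hlow : ∀ i ∈ Finset.range (c - b), Polynomial.C
      ((a.choose i : ZMod p) * (b.choose (c - i) : ZMod p)) * Polynomial.X ^ i = 0 := by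
    intro i hi
    have := Finset.mem_range.mp hi
    simp [Nat.choose_eq_zero_of_lt (show b < c - i by omega)]
  unfold fabc
  rw [show c + 1 = (c - b) + (b + 1) by omega, Finset.sum_range_add, Finset.sum_eq_zero hlow,
    zero_add, Finset.mul_sum]
  have hleft : Finset.range (min b (a + b - c) + 1) ⊆ Finset.range (b + 1) :=
    Finset.range_mono (by omega)
  have hright : Finset.range (min b (a + b - c) + 1) ⊆ Finset.range (a + b - c + 1) :=
    Finset.range_mono (by omega)
  rw [← Finset.sum_subset hleft, ← Finset.sum_subset hright]
  · refine Finset.sum_congr rfl fun j hj => ?_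
    have hj' := Finset.mem_range.mp hj
    rw [show c - (c - b + j) = b - j by omega, Nat.choose_symm (by omega : j ≤ b),
      Nat.choose_symm_of_eq_add (show a = (c - b + j) + (a + b - c - j) by omega), pow_add,
      mul_comm (a.choose _ : ZMod p)]
    ring
  · intro j hj hj'
    simp only [Finset.mem_range] at hj hj'
    simp [Nat.choose_eq_zero_of_lt (show b < j by omega)]
  · intro j hj hj'
    simp only [Finset.mem_range] at hj hj'
    simp [Nat.choose_eq_zero_of_lt (show a < c - b + j by omega)]

open Polynomial in
theorem fabc_eq_X_sub_one_pow_mul (p : ℕ) [Fact p.Prime] {a b c : ℕ} (ha : a ≤ p - 1)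
    (hb : b ≤ p - 1) (hab : p - 1 ≤ a + b) (hc : a + b - (p - 1) ≤ c) (hcp : c ≤ p - 1) :
    fabc p a b c = (-1) ^ (a + c) * (X - 1) ^ (a + b - (p - 1)) *
      fabc p (c + (p - 1) - (a + b)) ((p - 1) - c) ((p - 1) - b) := by
  have hp : p.Prime := Fact.out
  have hp1 := hp.one_le
  obtain ⟨d, hd⟩ : ∃ d, d = a + b - (p - 1) := ⟨_, rfl⟩
  rw [fabc_eq_sum_X_sub_one, fabc_eq_sum_X_sub_one, ← hd,
    show min a c + 1 = d + (min (c + (p - 1) - (a + b)) (p - 1 - b) + 1) by omega,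
    Finset.sum_range_add, Finset.sum_eq_zero, zero_add, Finset.mul_sum]
  · refine Finset.sum_congr rfl fun l hl => ?_
    have hl' := Finset.mem_range.mp hl
    obtain ⟨u, hu⟩ : ∃ u, c = d + l + u := ⟨c - (d + l), by omega⟩
    obtain ⟨v, hv⟩ : ∃ v, a = d + l + v := ⟨a - (d + l), by omega⟩
    have hcoeff : ((a.choose (d + l) * (a + b - (d + l)).choose (c - (d + l)) : ℕ) : ZMod p) =
        (-1) ^ (a + c) * (((c + (p - 1) - (a + b)).choose l *
          (c + (p - 1) - (a + b) + (p - 1 - c) - l).choose (p - 1 - b - l) : ℕ) : ZMod p) := by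
      rw [show a + b - (d + l) = p - 1 - l by omega, show c - (d + l) = u by omega,
        show c + (p - 1) - (a + b) = l + u by omega,
        show l + u + (p - 1 - c) - l = p - 1 - (d + l) by omega,
        show p - 1 - b - l = v by omega, Nat.cast_mul, Nat.cast_mul,
        ZMod.natCast_choose_pred_sub p l u (by omega),
        ZMod.natCast_choose_pred_sub p (d + l) v (by omega),
        Nat.choose_symm_add (a := l), hv, Nat.choose_symm_add (a := d + l),
        show d + l + v + c = 2 * (d + l) + u + v by omega]
      have hsq : ((-1 : ZMod p) ^ v) * (-1) ^ v = 1 := by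
        rw [← mul_pow]
        simp
      simp only [pow_add, pow_mul, neg_one_sq, one_pow, one_mul, mul_one]
      linear_combination (-(-1) ^ u * ((d + l + v).choose v : ZMod p) *
        ((l + u).choose u : ZMod p)) * hsq
    have hpoly := congrArg (C : ZMod p → (ZMod p)[X]) hcoeff
    simp only [map_mul, map_natCast, map_pow, map_neg, map_one] at hpoly
    rw [hpoly, pow_add]
    ring
  · intro k hk
    have hk' := Finset.mem_range.mp hk
    have hdvd : p ∣ (a + b - k).choose (c - k) := by
      have := hp.dvd_choose_add (a := c - k) (b := a + b - c) (by omega) (by omega) (by omega)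
      rwa [show c - k + (a + b - c) = a + b - k by omega] at this
    rw [(CharP.cast_eq_zero_iff (ZMod p)[X] p _).mpr (hdvd.mul_left _), zero_mul]

/-- Lemma `removing t and t-1`: in `F_p[t]`,
(1) if `b ≤ c ≤ a+b`, then `f(a,b,c) = t^{c-b}·f(b, a, a+b-c)`;
(2) if `a, b ≤ p-1`, `p-1 ≤ a+b` and `a+b-(p-1) ≤ c ≤ p-1`, then
`f(a,b,c) = (-1)^{a+c}·(t-1)^{a+b-(p-1)}·f(c-(a+b)+(p-1), (p-1)-c, (p-1)-b)`. -/
theorem stmt_9 (p : ℕ) (hp : p.Prime) (a b c : ℕ) :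
    (b ≤ c → c ≤ a + b →
      fabc p a b c = Polynomial.X ^ (c - b) * fabc p b a (a + b - c)) ∧
    (a ≤ p - 1 → b ≤ p - 1 → p - 1 ≤ a + b → a + b - (p - 1) ≤ c → c ≤ p - 1 →
      fabc p a b c = (-1) ^ (a + c) * (Polynomial.X - 1) ^ (a + b - (p - 1)) *
        fabc p (c + (p - 1) - (a + b)) ((p - 1) - c) ((p - 1) - b)) := by
  have : Fact p.Prime := ⟨hp⟩
  exact ⟨fabc_eq_X_pow_mul p, fabc_eq_X_sub_one_pow_mul p⟩
end

section
/- Let p be a prime and a, b, c nonnegative integers with a ≥ 1, b ≥ 1, and c ≥ 1. Then in F_p[t]: (a−c)·f(a,b−1,c) = a·f(a−1,b,c) + (c−a−b)·f(a,b−1,c−1), where the scalar coefficients a−c, a, and c−a−b are the images in F_p of the corresponding integers (which may be negative). -/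
theorem cast_sub_mul_choose_succ {R : Type*} [CommRing R] (n k : ℕ) :
    ((n : R) + 1 - k) * ((n + 1).choose k : R) = ((n : R) + 1) * (n.choose k : R) := by
  rcases le_or_gt k (n + 1) with h | h
  · have := congrArg (Nat.cast (R := R)) (Nat.choose_mul_succ_eq n k)
    push_cast [Nat.cast_sub h] at this
    linear_combination -this
  · simp [Nat.choose_eq_zero_of_lt h, Nat.choose_eq_zero_of_lt (Nat.lt_of_succ_lt h)]

/-- Second recurrence from the proof of Lemma `recurrance one`: in `F_p[t]`, for `a, b, c ≥ 1`,
`(a-c)·f(a,b-1,c) = a·f(a-1,b,c) + (c-a-b)·f(a,b-1,c-1)` (the scalars `a-c` and `c-a-b`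
being the images in `F_p` of the corresponding, possibly negative, integers). -/
theorem stmt_11 (p : ℕ) (hp : p.Prime) (a b c : ℕ) (ha : 1 ≤ a) (hb : 1 ≤ b) (hc : 1 ≤ c) :
    Polynomial.C ((((a : ℤ) - (c : ℤ) : ℤ) : ZMod p)) * fabc p a (b - 1) c
      = Polynomial.C ((a : ZMod p)) * fabc p (a - 1) b c
        + Polynomial.C ((((c : ℤ) - (a : ℤ) - (b : ℤ) : ℤ) : ZMod p)) *
            fabc p a (b - 1) (c - 1) := by
  obtain ⟨a, rfl⟩ := Nat.exists_eq_add_of_le' ha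
  obtain ⟨b, rfl⟩ := Nat.exists_eq_add_of_le' hb
  obtain ⟨c, rfl⟩ := Nat.exists_eq_add_of_le' hc
  simp only [fabc, Nat.add_sub_cancel]
  rw [Finset.sum_range_succ, Finset.sum_range_succ _ (c + 1), mul_add, mul_add, add_right_comm]
  simp only [Finset.mul_sum, ← Finset.sum_add_distrib, ← mul_assoc, ← Polynomial.C_mul]
  congr 1
  · refine Finset.sum_congr rfl fun i hi => ?_
    obtain ⟨j, rfl⟩ := Nat.exists_eq_add_of_le (Finset.mem_range_succ_iff.mp hi)
    rw [← add_mul, ← Polynomial.C_add]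
    congr 2
    have hj : i + j + 1 - i = j + 1 := by omega
    rw [hj, Nat.add_sub_cancel_left, Nat.choose_succ_succ' b j]
    have h₁ := cast_sub_mul_choose_succ (R := ZMod p) a i
    have h₂ := cast_succ_mul_choose_succ (R := ZMod p) b j
    push_cast
    linear_combination ((b.choose j : ZMod p) + (b.choose (j + 1) : ZMod p)) * h₁
      - ((a + 1).choose i : ZMod p) * h₂
  · congr 2
    have h := cast_sub_mul_choose_succ (R := ZMod p) a (c + 1)
    push_cast at h ⊢
    simp only [Nat.sub_self, Nat.choose_zero_right, Nat.cast_one]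
    linear_combination h
end

section
/- Let p be a prime and a, b, c positive integers with a ≤ p−1, b ≤ p−1, and c ≤ b. Assume moreover that either a+b ≤ p−1 or c ≤ a+b−p+1. Then the polynomials f(a,b,c) and f(a,b,c−1) are coprime in F_p[t], i.e. gcd(f(a,b,c), f(a,b,c−1)) = 1. -/
open Polynomial in
/-- `fabc p a b c` is the coefficient of `x ^ c` in `(1 + t x) ^ a (1 + x) ^ b`. -/
theorem coeff_eq_fabc (p a b c : ℕ) :
    ((1 + C (X : (ZMod p)[X]) * X) ^ a * (1 + X) ^ b).coeff c = fabc p a b c := by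
  have hcomp : (1 + C (X : (ZMod p)[X]) * X) ^ a = ((1 + X) ^ a).comp (C X * X) := by
    simp
  rw [hcomp, coeff_mul, Finset.Nat.sum_antidiagonal_eq_sum_range_succ_mk, fabc]
  refine Finset.sum_congr rfl fun i _ => ?_
  simp only [comp_C_mul_X_coeff, coeff_one_add_X_pow, map_mul, map_natCast]
  ring

open Polynomial in
/-- The three-term recurrence in `c`, obtained from the logarithmic derivative of the
generating function `(1 + t x) ^ a (1 + x) ^ b`. -/
theorem fabc_recurrence (p a b k : ℕ) (ha : 1 ≤ a) (hb : 1 ≤ b) :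
    ((k : (ZMod p)[X]) + 2) * fabc p a b (k + 2) =
      (((a : (ZMod p)[X]) - ((k : (ZMod p)[X]) + 1)) * X +
          ((b : (ZMod p)[X]) - ((k : (ZMod p)[X]) + 1))) *
        fabc p a b (k + 1) +
        ((a : (ZMod p)[X]) + (b : (ZMod p)[X]) - (k : (ZMod p)[X])) * X * fabc p a b k := by
  obtain ⟨m, rfl⟩ := Nat.exists_eq_add_of_le' ha
  obtain ⟨n, rfl⟩ := Nat.exists_eq_add_of_le' hb
  have key : ∀ G : (ZMod p)[X][X],
      G = (1 + C (X : (ZMod p)[X]) * X) ^ (m + 1) * (1 + X) ^ (n + 1) →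
      derivative G + C (1 + X) * (derivative G * X) + C X * (derivative G * X * X) =
        C ((m + 1 : ℕ) * X + (n + 1 : ℕ)) * G +
          C (((m + 1 : ℕ) + (n + 1 : ℕ)) * X) * (G * X) := by
    rintro G rfl
    simp only [derivative_mul, derivative_pow, derivative_one, derivative_X,
      derivative_C, Nat.add_sub_cancel, map_add, map_mul, map_natCast, map_one]
    push_cast
    ring
  have h := congrArg (fun P => coeff P (k + 1)) (key _ rfl)
  cases k with
  | zero =>
    simp only [coeff_add, coeff_C_mul, coeff_mul_X, coeff_derivative, coeff_eq_fabc,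
      coeff_mul_X_zero, mul_zero] at h
    push_cast at h ⊢
    linear_combination h
  | succ k =>
    simp only [coeff_add, coeff_C_mul, coeff_mul_X, coeff_derivative, coeff_eq_fabc] at h
    push_cast at h ⊢
    linear_combination h

open Polynomial in
theorem isCoprime_X_fabc {p b c : ℕ} (hp : p.Prime) (a : ℕ) (hb : b < p) (hc : c ≤ b) :
    IsCoprime (X : (ZMod p)[X]) (fabc p a b c) := by
  have : Fact p.Prime := ⟨hp⟩
  rw [irreducible_X.coprime_iff_not_dvd, X_dvd_iff, coeff_zero_eq_eval_zero]
  have heval : (fabc p a b c).eval 0 = (b.choose c : ZMod p) := by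
    rw [fabc, eval_finsetSum, Finset.sum_range_succ']
    simp
  rw [heval, ZMod.natCast_eq_zero_iff]
  intro hdvd
  have := (hp.dvd_factorial).1 (hdvd.trans
    ⟨c.factorial * (b - c).factorial, by
      rw [← mul_assoc, Nat.choose_mul_factorial_mul_factorial hc]⟩)
  omega

open Polynomial in
theorem isCoprime_fabc_succ {p a b : ℕ} (hp : p.Prime) (ha : 1 ≤ a) (hb : b < p) (k : ℕ)
    (hk : k + 1 ≤ b) (h : ∀ j, j + 2 ≤ k + 1 → ¬ p ∣ a + b - j) :
    IsCoprime (fabc p a b (k + 1)) (fabc p a b k) := by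
  have : Fact p.Prime := ⟨hp⟩
  induction k with
  | zero =>
    have : fabc p a b 0 = 1 := by simp [fabc]
    rw [this]
    exact isCoprime_one_right
  | succ k ih =>
    have hunit : IsUnit ((a : (ZMod p)[X]) + (b : (ZMod p)[X]) - (k : (ZMod p)[X])) := by
      have hcast : (a : (ZMod p)[X]) + (b : (ZMod p)[X]) - (k : (ZMod p)[X]) =
          C ((a + b - k : ℕ) : ZMod p) := by
        rw [Nat.cast_sub (by omega)]
        simp
      rw [hcast, isUnit_C, isUnit_iff_ne_zero, Ne, ZMod.natCast_eq_zero_iff]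
      exact h k le_rfl
    have hprod : IsCoprime
        (((a : (ZMod p)[X]) + (b : (ZMod p)[X]) - (k : (ZMod p)[X])) * X *
        fabc p a b k) (fabc p a b (k + 1)) := by
      refine IsCoprime.mul_left (IsCoprime.mul_left ?_ ?_) ?_
      · obtain ⟨u, hu⟩ := hunit.exists_left_inv
        exact ⟨u, 0, by rw [hu, zero_mul, add_zero]⟩
      · exact isCoprime_X_fabc hp a hb (by omega)
      · exact (ih (by omega) fun j hj => h j (by omega)).symm
    refine IsCoprime.of_mul_left_right (x := (k : (ZMod p)[X]) + 2) ?_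
    rw [fabc_recurrence p a b k ha (by omega), add_comm]
    exact hprod.add_mul_right_left _

/-- Lemma `recurrance one`: for positive `a, b, c` with `a, b ≤ p-1`, `c ≤ b`, and either
`a+b ≤ p-1` or `c ≤ a+b-p+1` (stated as `c + p ≤ a + b + 1` to avoid truncated
subtraction), the polynomials `f(a,b,c)` and `f(a,b,c-1)` are coprime in `F_p[t]`. -/
theorem stmt_12 (p : ℕ) (hp : p.Prime) (a b c : ℕ)
    (ha0 : 1 ≤ a) (hb0 : 1 ≤ b) (hc0 : 1 ≤ c)
    (ha : a ≤ p - 1) (hb : b ≤ p - 1) (hcb : c ≤ b)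
    (h : a + b ≤ p - 1 ∨ c + p ≤ a + b + 1) :
    IsCoprime (fabc p a b c) (fabc p a b (c - 1)) := by
  have hp2 := hp.two_le
  obtain ⟨k, rfl⟩ := Nat.exists_eq_add_of_le' hc0
  refine isCoprime_fabc_succ hp ha0 (by omega) k hcb ?_
  rintro j hj ⟨q, hq⟩
  rcases q with _ | _ | q
  · omega
  · omega
  · have : p * (q + 1 + 1) = p * q + 2 * p := by ring
    have := Nat.zero_le (p * q)
    omega
end

section
/- Let p be a prime with p ≡ 6 (mod 7) (hence p ≡ 13 (mod 14)). Set φ₂ = f((2p−5)/7, (2p−5)/7, (p−6)/7) and φ₃ = f((3p−4)/7, (3p−4)/7, (5p−2)/7) in F_p[t] (the displayed quotients are integers since p ≡ 6 mod 7). Then φ₂(−1) = 0 and φ₃(−1) = 0. -/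
theorem eval_neg_one_fabc_self {p a c : ℕ} (hp : p.Prime) (hp2 : p ≠ 2) (hc : Odd c) :
    Polynomial.eval (-1 : ZMod p) (fabc p a a c) = 0 := by
  have := Fact.mk hp
  have key : Polynomial.eval (-1 : ZMod p) (fabc p a a c)
      = -Polynomial.eval (-1 : ZMod p) (fabc p a a c) := by
    simp only [fabc, Polynomial.eval_finsetSum, Polynomial.eval_mul, Polynomial.eval_C,
      Polynomial.eval_pow, Polynomial.eval_X]
    conv_lhs => rw [← Finset.sum_range_reflect]
    rw [← Finset.sum_neg_distrib]
    refine Finset.sum_congr rfl fun i hi => ?_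
    have hi : i ≤ c := Nat.lt_succ_iff.mp (Finset.mem_range.mp hi)
    have hsign : (-1 : ZMod p) ^ (c - i) = -(-1) ^ i := by
      rcases Nat.even_or_odd i with h | h
      · rw [(Nat.Odd.sub_even hi hc h).neg_one_pow, h.neg_one_pow]
      · rw [(Nat.Odd.sub_odd hc h).neg_one_pow, h.neg_one_pow, neg_neg]
    rw [Nat.add_sub_cancel, Nat.sub_sub_self hi, hsign]
    ring
  have two_ne_zero : (2 : ZMod p) ≠ 0 := Ring.two_ne_zero (by rwa [ZMod.ringChar_zmod_n])
  exact (mul_eq_zero_iff_left two_ne_zero).mp (by linear_combination key)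

/-- Lemma `last`: for a prime `p ≡ 6 (mod 7)`, the polynomials
`φ₂ = f((2p-5)/7, (2p-5)/7, (p-6)/7)` and `φ₃ = f((3p-4)/7, (3p-4)/7, (5p-2)/7)` both
vanish at `t = -1`. -/
theorem stmt_18 (p : ℕ) (hp : p.Prime) (hmod : p % 7 = 6) :
    Polynomial.eval (-1 : ZMod p)
        (fabc p ((2 * p - 5) / 7) ((2 * p - 5) / 7) ((p - 6) / 7)) = 0 ∧
    Polynomial.eval (-1 : ZMod p)
        (fabc p ((3 * p - 4) / 7) ((3 * p - 4) / 7) ((5 * p - 2) / 7)) = 0 := by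
  have hp2 : p ≠ 2 := by omega
  have hodd : p % 2 = 1 := hp.eq_two_or_odd.resolve_left hp2
  exact ⟨eval_neg_one_fabc_self hp hp2 (Nat.odd_iff.mpr (by omega)),
    eval_neg_one_fabc_self hp hp2 (Nat.odd_iff.mpr (by omega))⟩
end
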